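/- Let $n, p \in \mathbb{N}$ with $n \geq 1$, let $a \in (0,2]$ be fixed, let $x_1,\ldots,x_n \in [0,1]^p$ be design points, let $\Theta \subseteq \mathbb{R}^k$, and let $f : \Theta \to \mathbb{R}^n$ be continuous. For $\rho = (\rho_1,\ldots,\rho_p) \in [0,1]^p$ let $R(\rho)$ be the $n \times n$ matrix with $(i,j)$ entry $\prod_{\ell=1}^{p} \rho_\ell^{2^a |x_{\ell i} - x_{\ell j}|^a}$ (with the convention $0^0 = 1$, so diagonal entries equal $1$), and assume $R(\rho)$ is symmetric positive semidefinite for every $\rho \in [0,1]^p$. Let $\pi_\eta$ be a bounded probability density for $\eta = (\sigma^2, \sigma_0^2, \theta)$ with compact support $K \subset (0,\infty) \times (0,\infty) \times \Theta$ not containing any point with $\sigma^2 = 0$ or $\sigma_0^2 = 0$. For $y \in \mathbb{R}^n$ define the marginal with a Beta$(\alpha,1)$ spike on $\rho_1$: $m_\alpha(y) = \int_K \int_{[0,1]^{p-1}} \int_0^1 \varphi\big(y; f(\theta), \sigma^2 R(\rho) + \sigma_0^2 I_n\big)\, \alpha \rho_1^{\alpha-1} \, d\rho_1 \, d\rho_2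 \cdots d\rho_p \, \pi_\eta(\eta)\, d\eta$, where $\varphi(y; \mu, \Sigma) = (2\pi)^{-n/2} (\det \Sigma)^{-1/2} \exp\big(-\tfrac{1}{2}(y-\mu)^\top \Sigma^{-1}(y-\mu)\big)$. Then $\lim_{\alpha \to \infty} m_\alpha(y) = \int_K \int_{[0,1]^{p-1}} \varphi\big(y; f(\theta), \sigma^2 R(1, \rho_2,\ldots,\rho_p) + \sigma_0^2 I_n\big)\, d\rho_2 \cdots d\rho_p \, \pi_\eta(\eta)\, d\eta$, i.e., the marginal of the model in which $\rho_1$ is fixed at $1$ (equivalently, the first input variable is removed from the discrepancy function). -/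

import Mathlib

open Matrix MeasureTheory Filter

/-- The `n`-dimensional Gaussian density `φ(y; μ, Σ)`. -/
noncomputable def gaussDensity {n : ℕ} (y μ : Fin n → ℝ)
    (S : Matrix (Fin n) (Fin n) ℝ) : ℝ :=
  (2 * Real.pi) ^ (-(n : ℝ) / 2) * S.det ^ (-(1 : ℝ) / 2) *
    Real.exp (-(1 / 2 : ℝ) * ((y - μ) ⬝ᵥ (S⁻¹ *ᵥ (y - μ))))

/-- The separable power exponential correlation matrix in the Linkletter et al.
parametrization: entry `(i,j)` is `∏ₗ ρₗ^(2^a |x_{ℓ i} - x_{ℓ j}|^a)` (with `0^0 = 1`,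
as for `Real.rpow`, so diagonal entries equal `1`). -/
noncomputable def corrMat {n p : ℕ} (a : ℝ) (x : Fin p → Fin n → ℝ)
    (ρ : Fin p → ℝ) : Matrix (Fin n) (Fin n) ℝ :=
  Matrix.of fun i j => ∏ ℓ, (ρ ℓ) ^ ((2 : ℝ) ^ a * |x ℓ i - x ℓ j| ^ a)

/-- Dominated convergence on a compact set for a uniformly bounded family of continuous functions,
against an integrable weight. -/
theorem tendsto_setIntegral_mul_of_continuousOn_of_bounded {X : Type*} [TopologicalSpace X]
    [T2Space X] [MeasurableSpace X] [BorelSpace X] {μ : Measure X} {K : Set X} (hK : IsCompact K)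
    {w : X → ℝ} (hw : IntegrableOn w K μ) {F : ℝ → X → ℝ} {F₀ : X → ℝ} {C : ℝ}
    (hF : ∀ᶠ α in atTop, ContinuousOn (F α) K)
    (hC : ∀ᶠ α in atTop, ∀ x ∈ K, ‖F α x‖ ≤ C)
    (hlim : ∀ x ∈ K, Tendsto (fun α => F α x) atTop (nhds (F₀ x))) :
    Tendsto (fun α => ∫ x in K, F α x * w x ∂μ) atTop (nhds (∫ x in K, F₀ x * w x ∂μ)) := by
  refine tendsto_integral_filter_of_dominated_convergence (fun x => C * ‖w x‖) ?_ ?_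
    (hw.norm.const_mul C) ?_
  · filter_upwards [hF] with α hα
    exact (hα.aestronglyMeasurable_of_isCompact hK hK.measurableSet).mul hw.aestronglyMeasurable
  · filter_upwards [hC] with α hα
    filter_upwards [ae_restrict_mem hK.measurableSet] with x hx
    rw [norm_mul]
    exact mul_le_mul_of_nonneg_right (hα x hx) (norm_nonneg _)
  · filter_upwards [ae_restrict_mem hK.measurableSet] with x hx
    exact (hlim x hx).mul_const _

theorem tendsto_setIntegral_of_continuousOn_of_bounded {X : Type*} [TopologicalSpace X]
    [T2Space X] [MeasurableSpace X] [BorelSpace X] {μ : Measure X} [IsFiniteMeasureOnCompacts μ]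
    {K : Set X} (hK : IsCompact K) {F : ℝ → X → ℝ} {F₀ : X → ℝ} {C : ℝ}
    (hF : ∀ᶠ α in atTop, ContinuousOn (F α) K)
    (hC : ∀ᶠ α in atTop, ∀ x ∈ K, ‖F α x‖ ≤ C)
    (hlim : ∀ x ∈ K, Tendsto (fun α => F α x) atTop (nhds (F₀ x))) :
    Tendsto (fun α => ∫ x in K, F α x ∂μ) atTop (nhds (∫ x in K, F₀ x ∂μ)) := by
  simpa using tendsto_setIntegral_mul_of_continuousOn_of_bounded (μ := μ) hK
    (w := fun _ => (1 : ℝ)) (integrableOn_const hK.measure_lt_top.ne) hF hC hlim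

theorem continuousOn_setIntegral_of_isCompact_prod {X Y : Type*} [TopologicalSpace X]
    [FirstCountableTopology X] [TopologicalSpace Y] [T2Space Y] [MeasurableSpace Y] [BorelSpace Y]
    {μ : Measure Y} [IsFiniteMeasureOnCompacts μ] {K : Set X} {Q : Set Y} (hK : IsCompact K)
    (hQ : IsCompact Q) {G : X × Y → ℝ} (hG : ContinuousOn G (K ×ˢ Q)) :
    ContinuousOn (fun x => ∫ y in Q, G (x, y) ∂μ) K := by
  obtain ⟨C, hC⟩ := (hK.prod hQ).exists_bound_of_continuousOn hG
  refine continuousOn_of_dominated (bound := fun _ => C) ?_ ?_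
    (integrableOn_const hQ.measure_lt_top.ne) ?_
  · intro x hx
    exact (hG.comp (by fun_prop) fun y hy => ⟨hx, hy⟩).aestronglyMeasurable_of_isCompact hQ
      hQ.measurableSet
  · intro x hx
    filter_upwards [ae_restrict_mem hQ.measurableSet] with y hy using hC _ ⟨hx, hy⟩
  · filter_upwards [ae_restrict_mem hQ.measurableSet] with y hy
    exact hG.comp (by fun_prop) fun x hx => ⟨hx, hy⟩

/-- Substituting `u = t ^ α` turns a Beta(α,1) expectation into a uniform one. -/
theorem integral_mul_beta_density_eq {h : ℝ → ℝ} (hh : ContinuousOn h (Set.Icc 0 1)) {α : ℝ}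
    (hα : 1 ≤ α) :
    ∫ t in (0 : ℝ)..1, h t * (α * t ^ (α - 1)) =
      ∫ u in Set.Icc (0 : ℝ) 1, h (u ^ α⁻¹) := by
  have hα0 : 0 < α := by linarith
  have hmaps : ∀ u ∈ Set.Icc (0 : ℝ) 1, ∀ c : ℝ, 0 ≤ c → u ^ c ∈ Set.Icc (0 : ℝ) 1 :=
    fun u hu c hc => ⟨Real.rpow_nonneg hu.1 _, Real.rpow_le_one hu.1 hu.2 hc⟩
  have key := intervalIntegral.integral_comp_mul_deriv' (a := 0) (b := 1)
    (f := fun t : ℝ => t ^ α) (f' := fun t => α * t ^ (α - 1)) (g := fun u => h (u ^ α⁻¹))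
    (fun t _ => Real.hasDerivAt_rpow_const (Or.inr hα))
    ((continuous_const.mul (Real.continuous_rpow_const (by linarith))).continuousOn) ?_
  · rw [integral_Icc_eq_integral_Ioc, ← intervalIntegral.integral_of_le zero_le_one]
    simp only [Real.zero_rpow hα0.ne', Real.one_rpow] at key
    rw [← key]
    refine intervalIntegral.integral_congr fun t ht => ?_
    rw [Set.uIcc_of_le zero_le_one] at ht
    simp only [Function.comp, Real.rpow_rpow_inv ht.1 hα0.ne']
  · refine hh.comp (Real.continuous_rpow_const (inv_nonneg.2 hα0.le)).continuousOn ?_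
    rintro _ ⟨t, ht, rfl⟩
    rw [Set.uIcc_of_le zero_le_one] at ht
    exact hmaps _ (hmaps t ht α hα0.le) _ (inv_nonneg.2 hα0.le)

/-- Mixing a jointly continuous function on a compact product against a Beta(α,1) density in its
last variable amounts, as `α → ∞`, to evaluating that variable at `1`. -/
theorem tendsto_integral_beta_spike {X Y : Type*} [TopologicalSpace X] [FirstCountableTopology X]
    [T2Space X] [MeasurableSpace X] [BorelSpace X] [TopologicalSpace Y] [FirstCountableTopology Y]
    [T2Space Y] [MeasurableSpace Y] [BorelSpace Y] {μ : Measure X} {ν : Measure Y}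
    [IsFiniteMeasureOnCompacts ν] {K : Set X} {Q : Set Y} (hK : IsCompact K) (hQ : IsCompact Q)
    {w : X → ℝ} (hw : IntegrableOn w K μ) {G : (X × Y) × ℝ → ℝ}
    (hG : ContinuousOn G ((K ×ˢ Q) ×ˢ Set.Icc 0 1)) :
    Tendsto
      (fun α : ℝ => ∫ e in K,
        (∫ r in Q, (∫ t in (0 : ℝ)..1, G ((e, r), t) * (α * t ^ (α - 1))) ∂ν) * w e ∂μ)
      atTop (nhds (∫ e in K, (∫ r in Q, G ((e, r), 1) ∂ν) * w e ∂μ)) := by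
  obtain ⟨C, hC⟩ := ((hK.prod hQ).prod isCompact_Icc).exists_bound_of_continuousOn hG
  have hslice : ∀ z ∈ K ×ˢ Q, ContinuousOn (fun t => G (z, t)) (Set.Icc 0 1) := fun z hz =>
    hG.comp (by fun_prop) fun t ht => ⟨hz, ht⟩
  have hroot : ∀ α : ℝ, 1 ≤ α → ∀ u ∈ Set.Icc (0 : ℝ) 1, u ^ α⁻¹ ∈ Set.Icc (0 : ℝ) 1 :=
    fun α hα u hu => ⟨Real.rpow_nonneg hu.1 _,
      Real.rpow_le_one hu.1 hu.2 (inv_nonneg.2 (by linarith))⟩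
  have hcont : ∀ α : ℝ, 1 ≤ α → ContinuousOn
      (fun z : X × Y => ∫ t in (0 : ℝ)..1, G (z, t) * (α * t ^ (α - 1))) (K ×ˢ Q) := by
    intro α hα
    have hc : Continuous fun u : ℝ => u ^ α⁻¹ :=
      Real.continuous_rpow_const (inv_nonneg.2 (by linarith))
    refine (continuousOn_setIntegral_of_isCompact_prod (μ := volume) (hK.prod hQ) isCompact_Icc
      (G := fun q => G (q.1, q.2 ^ α⁻¹)) ?_).congr
      fun z hz => integral_mul_beta_density_eq (hslice z hz) hα
    exact hG.comp (by fun_prop) fun q hq => ⟨hq.1, hroot α hα _ hq.2⟩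
  have hbound : ∀ α : ℝ, 1 ≤ α → ∀ z ∈ K ×ˢ Q,
      ‖∫ t in (0 : ℝ)..1, G (z, t) * (α * t ^ (α - 1))‖ ≤ C := by
    intro α hα z hz
    rw [integral_mul_beta_density_eq (hslice z hz) hα]
    simpa using norm_setIntegral_le_of_norm_le_const (μ := volume) (s := Set.Icc (0 : ℝ) 1)
      (by simp) fun u hu => hC (z, u ^ α⁻¹) ⟨hz, hroot α hα u hu⟩
  have hpoint : ∀ z ∈ K ×ˢ Q, Tendsto
      (fun α : ℝ => ∫ t in (0 : ℝ)..1, G (z, t) * (α * t ^ (α - 1))) atTop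
      (nhds (G (z, 1))) := by
    intro z hz
    have hlim : Tendsto (fun α : ℝ => ∫ u in (0 : ℝ)..1, G (z, u ^ α⁻¹)) atTop
        (nhds (∫ _ in (0 : ℝ)..1, G (z, 1))) := by
      refine intervalIntegral.tendsto_integral_filter_of_dominated_convergence (fun _ => C) ?_ ?_
        (by simp) ?_
      · filter_upwards [eventually_ge_atTop 1] with α hα
        rw [Set.uIoc_of_le zero_le_one]
        refine ((hslice z hz).comp (Real.continuous_rpow_const
          (inv_nonneg.2 (by linarith))).continuousOn fun u hu =>
            hroot α hα u (Set.Ioc_subset_Icc_self hu)).aestronglyMeasurable measurableSet_Ioc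
      · filter_upwards [eventually_ge_atTop 1] with α hα
        refine .of_forall fun u hu => hC (z, u ^ α⁻¹) ⟨hz, hroot α hα u ?_⟩
        rw [Set.uIoc_of_le zero_le_one] at hu
        exact Set.Ioc_subset_Icc_self hu
      · refine .of_forall fun u hu => ?_
        rw [Set.uIoc_of_le zero_le_one] at hu
        have hu1 : Tendsto (fun α : ℝ => u ^ α⁻¹) atTop (nhds 1) := by
          simpa [Function.comp_def] using
            (Real.continuousAt_const_rpow (b := 0) hu.1.ne').tendsto.comp
              (tendsto_inv_atTop_zero (𝕜 := ℝ))
        refine (hslice z hz 1 (by simp)).tendsto.comp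
          (tendsto_nhdsWithin_iff.2 ⟨hu1, ?_⟩)
        filter_upwards [eventually_ge_atTop 1] with α hα
        exact hroot α hα u (Set.Ioc_subset_Icc_self hu)
    simp only [intervalIntegral.integral_const, sub_zero, one_smul] at hlim
    refine hlim.congr' ?_
    filter_upwards [eventually_ge_atTop 1] with α hα
    rw [integral_mul_beta_density_eq (hslice z hz) hα, integral_Icc_eq_integral_Ioc,
      intervalIntegral.integral_of_le zero_le_one]
  refine tendsto_setIntegral_mul_of_continuousOn_of_bounded hK hw (C := C * ν.real Q) ?_ ?_ ?_
  · filter_upwards [eventually_ge_atTop 1] with α hα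
    exact continuousOn_setIntegral_of_isCompact_prod hK hQ (hcont α hα)
  · filter_upwards [eventually_ge_atTop 1] with α hα e he
    exact norm_setIntegral_le_of_norm_le_const hQ.measure_lt_top
      fun r hr => hbound α hα (e, r) ⟨he, hr⟩
  · intro e he
    refine tendsto_setIntegral_of_continuousOn_of_bounded hQ (C := C) ?_ ?_
      fun r hr => hpoint (e, r) ⟨he, hr⟩
    · filter_upwards [eventually_ge_atTop 1] with α hα
      exact (hcont α hα).comp (by fun_prop) fun r hr => ⟨he, hr⟩
    · filter_upwards [eventually_ge_atTop 1] with α hα r hr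
      exact hbound α hα (e, r) ⟨he, hr⟩

theorem continuous_corrMat {n p : ℕ} (a : ℝ) (x : Fin p → Fin n → ℝ) :
    Continuous (corrMat a x) := by
  refine continuous_matrix fun i j => ?_
  simp only [corrMat, Matrix.of_apply]
  exact continuous_finsetProd _ fun ℓ _ =>
    (continuous_apply ℓ).rpow_const fun _ => Or.inr (by positivity)

theorem ContinuousOn.gaussDensity {Z : Type*} [TopologicalSpace Z] {n : ℕ} (y : Fin n → ℝ)
    {m : Z → Fin n → ℝ} {S : Z → Matrix (Fin n) (Fin n) ℝ} {s : Set Z} (hm : ContinuousOn m s)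
    (hS : ContinuousOn S s) (hpos : ∀ z ∈ s, (S z).PosDef) :
    ContinuousOn (fun z => _root_.gaussDensity y (m z) (S z)) s := by
  have hdet : ContinuousOn (fun z => (S z).det) s :=
    (continuous_id.matrix_det).comp_continuousOn hS
  have hinv : ContinuousOn (fun z => (S z)⁻¹) s := by
    simp only [Matrix.inv_def, Ring.inverse_eq_inv']
    exact (hdet.inv₀ fun z hz => (hpos z hz).det_pos.ne').smul
      ((continuous_id.matrix_adjugate).comp_continuousOn hS)
  have hsub : ContinuousOn (fun z => y - m z) s := continuousOn_const.sub hm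
  have hmul : ContinuousOn (fun z => (S z)⁻¹ *ᵥ (y - m z)) s :=
    (continuous_fst.matrix_mulVec continuous_snd).comp_continuousOn (hinv.prodMk hsub)
  have hquad : ContinuousOn (fun z => (y - m z) ⬝ᵥ ((S z)⁻¹ *ᵥ (y - m z))) s :=
    (continuous_fst.dotProduct continuous_snd).comp_continuousOn (hsub.prodMk hmul)
  exact (continuousOn_const.mul
    (hdet.rpow_const fun z hz => Or.inl (hpos z hz).det_pos.ne')).mul
    (continuousOn_const.mul hquad).rexp

/-- Theorem 1 of the paper (with `p + 1 ≥ 1` input variables, the first of which carries the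
spike): as the Beta(α,1) spike parameter `α → ∞`, the continuous spike-and-slab marginal
`m_α(y)` converges to the marginal of the model in which `ρ₁` is fixed at `1`, i.e. the
model where the first input variable is removed from the discrepancy function. The prior
`π_η` on `η = (σ², σ₀², θ)` is a bounded probability density with compact support `K`
contained in `(0,∞) × (0,∞) × Θ`, and `f` (the computer model restricted to the design
points) is continuous on `Θ`. -/
theorem spike_and_slab_marginal_tendsto_reduced_model_marginal
    (n p k : ℕ) (hn : 1 ≤ n) (a : ℝ) (ha : 0 < a) (ha' : a ≤ 2)
    (x : Fin (p + 1) → Fin n → ℝ) (hx : ∀ ℓ i, x ℓ i ∈ Set.Icc (0 : ℝ) 1)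
    (Θ : Set (Fin k → ℝ)) (f : (Fin k → ℝ) → Fin n → ℝ) (hf : ContinuousOn f Θ)
    (hR : ∀ ρ : Fin (p + 1) → ℝ, (∀ ℓ, ρ ℓ ∈ Set.Icc (0 : ℝ) 1) →
      (corrMat a x ρ).PosSemidef)
    (πη : ℝ × ℝ × (Fin k → ℝ) → ℝ) (K : Set (ℝ × ℝ × (Fin k → ℝ)))
    (hπnn : ∀ e, 0 ≤ πη e) (hπbdd : ∃ M : ℝ, ∀ e, πη e ≤ M)
    (hKcomp : IsCompact K)
    (hKsub : K ⊆ {e : ℝ × ℝ × (Fin k → ℝ) | 0 < e.1 ∧ 0 < e.2.1 ∧ e.2.2 ∈ Θ})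
    (hsupp : Function.support πη ⊆ K)
    (hprob : ∫ e, πη e = 1)
    (y : Fin n → ℝ) :
    Tendsto
      (fun α : ℝ =>
        ∫ e in K,
          (∫ ρr in Set.univ.pi fun _ : Fin p => Set.Icc (0 : ℝ) 1,
            ∫ ρ1 in (0 : ℝ)..1,
              gaussDensity y (f e.2.2)
                  (e.1 • corrMat a x (Fin.cons ρ1 ρr) +
                    e.2.1 • (1 : Matrix (Fin n) (Fin n) ℝ)) *
                (α * ρ1 ^ (α - 1))) * πη e)
      atTop
      (nhds
        (∫ e in K,
          (∫ ρr in Set.univ.pi fun _ : Fin p => Set.Icc (0 : ℝ) 1,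
            gaussDensity y (f e.2.2)
              (e.1 • corrMat a x (Fin.cons (1 : ℝ) ρr) +
                e.2.1 • (1 : Matrix (Fin n) (Fin n) ℝ))) * πη e)) := by
  have hπint : Integrable πη := by
    by_contra h
    rw [integral_undef h] at hprob
    exact zero_ne_one hprob
  have hQ : IsCompact (Set.univ.pi fun _ : Fin p => Set.Icc (0 : ℝ) 1) :=
    isCompact_univ_pi fun _ => isCompact_Icc
  refine tendsto_integral_beta_spike hKcomp hQ hπint.integrableOn
    (G := fun q => gaussDensity y (f q.1.1.2.2)
      (q.1.1.1 • corrMat a x (Fin.cons q.2 q.1.2) +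
        q.1.1.2.1 • (1 : Matrix (Fin n) (Fin n) ℝ))) ?_
  refine ContinuousOn.gaussDensity y ?_ ?_ ?_
  · exact hf.comp (by fun_prop) fun q hq => (hKsub hq.1.1).2.2
  · have hcons : Continuous fun q : ((ℝ × ℝ × (Fin k → ℝ)) × (Fin p → ℝ)) × ℝ =>
        (Fin.cons q.2 q.1.2 : Fin (p + 1) → ℝ) := by
      refine continuous_pi fun ℓ => ?_
      refine Fin.cases ?_ (fun j => ?_) ℓ
      · simpa using continuous_snd
      · simp only [Fin.cons_succ]
        fun_prop
    have hcorr := (continuous_corrMat a x).comp hcons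
    have hσ : Continuous fun q : ((ℝ × ℝ × (Fin k → ℝ)) × (Fin p → ℝ)) × ℝ => q.1.1.1 := by
      fun_prop
    have hσ₀ : Continuous fun q : ((ℝ × ℝ × (Fin k → ℝ)) × (Fin p → ℝ)) × ℝ => q.1.1.2.1 := by
      fun_prop
    exact ((hσ.smul hcorr).add (hσ₀.smul continuous_const)).continuousOn
  · intro q hq
    obtain ⟨h1, h2, -⟩ := hKsub hq.1.1
    refine Matrix.PosDef.posSemidef_add ((hR _ fun ℓ => ?_).smul h1.le)
      (Matrix.PosDef.one.smul h2)
    refine Fin.cases ?_ (fun j => ?_) ℓ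
    · simpa using hq.2
    · simpa using hq.1.2 j (Set.mem_univ j)
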